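/- arXiv:math/9908163 — 3 statements merged into one kernel-verified Lean document; each statement's English description precedes it below -/
import Mathlib

section
/- For all nonnegative integers i, j with j ≤ i, and for any real α and real x, one has ∑_{k=j}^{i} L_{i-k}^{(-α-2)}(-x) · L_{k-j}^{(α)}(x) = δ_{ij} (Kronecker delta). -/
/-- The Laguerre polynomial with arbitrary real parameter `α`:
`L_n^{(α)}(x) = ∑_{k=0}^{n} (-1)^k (α+k+1)_{n-k}/(n-k)! · x^k/k!`. -/
noncomputable def laguerre (α : ℝ) (n : ℕ) (x : ℝ) : ℝ :=
  ∑ k ∈ Finset.range (n + 1),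
    (-1 : ℝ) ^ k * ((ascPochhammer ℝ (n - k)).eval (α + k + 1) / (Nat.factorial (n - k))) *
      (x ^ k / (Nat.factorial k))

open Finset in
/-- Interchange of the two groupings of the four summands in `a + b + c + d = n`. -/
theorem sum_antidiagonal_antidiagonal_comm {M : Type*} [AddCommMonoid M]
    (f : ℕ → ℕ → ℕ → ℕ → M) (n : ℕ) :
    ∑ m ∈ HasAntidiagonal.antidiagonal n, ∑ p ∈ HasAntidiagonal.antidiagonal m.1,
        ∑ q ∈ HasAntidiagonal.antidiagonal m.2, f p.1 p.2 q.1 q.2 =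
      ∑ m ∈ HasAntidiagonal.antidiagonal n, ∑ p ∈ HasAntidiagonal.antidiagonal m.1,
        ∑ q ∈ HasAntidiagonal.antidiagonal m.2, f p.1 q.1 p.2 q.2 := by
  simp_rw [← sum_product', sum_sigma']
  refine sum_bij'
    (fun z _ ↦ ⟨(z.2.1.1 + z.2.2.1, z.2.1.2 + z.2.2.2),
      ((z.2.1.1, z.2.2.1), (z.2.1.2, z.2.2.2))⟩)
    (fun z _ ↦ ⟨(z.2.1.1 + z.2.2.1, z.2.1.2 + z.2.2.2),
      ((z.2.1.1, z.2.2.1), (z.2.1.2, z.2.2.2))⟩) ?_ ?_ ?_ ?_ ?_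
  · rintro ⟨⟨a, b⟩, ⟨c, d⟩, ⟨e, g⟩⟩ h
    simp only [mem_sigma, mem_product, HasAntidiagonal.mem_antidiagonal, and_self, and_true] at h ⊢
    omega
  · rintro ⟨⟨a, b⟩, ⟨c, d⟩, ⟨e, g⟩⟩ h
    simp only [mem_sigma, mem_product, HasAntidiagonal.mem_antidiagonal, and_self, and_true] at h ⊢
    omega
  · rintro ⟨⟨a, b⟩, ⟨c, d⟩, ⟨e, g⟩⟩ h
    simp only [mem_sigma, mem_product, HasAntidiagonal.mem_antidiagonal] at h
    obtain ⟨-, rfl, rfl⟩ := h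
    rfl
  · rintro ⟨⟨a, b⟩, ⟨c, d⟩, ⟨e, g⟩⟩ h
    simp only [mem_sigma, mem_product, HasAntidiagonal.mem_antidiagonal] at h
    obtain ⟨-, rfl, rfl⟩ := h
    rfl
  · intros
    rfl

/-- The Chu-Vandermonde identity for `Ring.multichoose`. -/
theorem add_multichoose_eq {R : Type*} [CommRing R] [BinomialRing R] (r s : R) (n : ℕ) :
    Ring.multichoose (r + s) n =
      ∑ p ∈ Finset.HasAntidiagonal.antidiagonal n,
        Ring.multichoose r p.1 * Ring.multichoose s p.2 := by
  have key (t : R) (k : ℕ) : Ring.multichoose t k = (-1) ^ k * Ring.choose (-t) k := by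
    rw [Ring.choose_neg', Int.negOnePow_def, Units.smul_def, zsmul_eq_mul, ← mul_assoc]
    simp [← mul_pow]
  rw [key, neg_add, Ring.add_choose_eq n (Commute.all _ _), Finset.mul_sum]
  refine Finset.sum_congr rfl fun p hp ↦ ?_
  rw [key, key, ← Finset.HasAntidiagonal.mem_antidiagonal.1 hp, pow_add]
  ring

theorem multichoose_eq_ascPochhammer_eval_div (r : ℝ) (n : ℕ) :
    Ring.multichoose r n = (ascPochhammer ℝ n).eval r / n.factorial := by
  rw [eq_div_iff (by positivity), ← Polynomial.ascPochhammer_smeval_eq_eval,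
    ← Ring.factorial_nsmul_multichoose_eq_ascPochhammer, nsmul_eq_mul, mul_comm]

theorem sum_antidiagonal_pow_div_factorial (x y : ℝ) (n : ℕ) :
    ∑ p ∈ Finset.HasAntidiagonal.antidiagonal n,
        x ^ p.1 / p.1.factorial * (y ^ p.2 / p.2.factorial) =
      (x + y) ^ n / n.factorial := by
  rw [(Commute.all x y).add_pow', Finset.sum_div]
  refine Finset.sum_congr rfl fun p hp ↦ ?_
  rw [← Finset.HasAntidiagonal.mem_antidiagonal.1 hp, nsmul_eq_mul, Nat.cast_add_choose]
  field_simp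

theorem laguerre_eq_sum_antidiagonal (α : ℝ) (n : ℕ) (x : ℝ) :
    laguerre α n x = ∑ p ∈ Finset.HasAntidiagonal.antidiagonal n,
      (-x) ^ p.1 / p.1.factorial * Ring.multichoose (α + p.1 + 1) p.2 := by
  rw [Finset.Nat.sum_antidiagonal_eq_sum_range_succ_mk, laguerre]
  refine Finset.sum_congr rfl fun k _ ↦ ?_
  rw [multichoose_eq_ascPochhammer_eval_div, neg_pow]
  ring

/-- The addition formula for Laguerre polynomials. -/
theorem sum_antidiagonal_laguerre_mul_laguerre (α β x y : ℝ) (n : ℕ) :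
    ∑ m ∈ Finset.HasAntidiagonal.antidiagonal n, laguerre α m.1 x * laguerre β m.2 y =
      laguerre (α + β + 1) n (x + y) := by
  simp_rw [laguerre_eq_sum_antidiagonal, Finset.sum_mul_sum]
  rw [sum_antidiagonal_antidiagonal_comm fun a b c d ↦
    (-x) ^ a / a.factorial * Ring.multichoose (α + a + 1) b *
      ((-y) ^ c / c.factorial * Ring.multichoose (β + c + 1) d)]
  refine Finset.sum_congr rfl fun m _ ↦ ?_
  rw [neg_add, ← sum_antidiagonal_pow_div_factorial, Finset.sum_mul]
  refine Finset.sum_congr rfl fun p hp ↦ ?_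
  have h : α + β + 1 + (m.1 : ℝ) + 1 = (α + p.1 + 1) + (β + p.2 + 1) := by
    rw [← Finset.HasAntidiagonal.mem_antidiagonal.1 hp]
    push_cast
    ring
  rw [h, add_multichoose_eq, Finset.mul_sum]
  refine Finset.sum_congr rfl fun q _ ↦ ?_
  ring

theorem laguerre_neg_one_zero (n : ℕ) : laguerre (-1) n 0 = if n = 0 then 1 else 0 := by
  rw [laguerre, Finset.sum_range_succ']
  cases n <;> simp

/-- Inversion formula for the Laguerre polynomials:
`∑_{k=j}^{i} L_{i-k}^{(-α-2)}(-x) L_{k-j}^{(α)}(x) = δ_{ij}`. -/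
theorem laguerre_inversion' (α x : ℝ) (i j : ℕ) (hij : j ≤ i) :
    ∑ k ∈ Finset.Icc j i,
        laguerre (-α - 2) (i - k) (-x) * laguerre α (k - j) x =
      if i = j then 1 else 0 := by
  obtain ⟨n, rfl⟩ := Nat.exists_eq_add_of_le hij
  have h := sum_antidiagonal_laguerre_mul_laguerre α (-α - 2) x (-x) n
  rw [show α + (-α - 2) + 1 = -1 by ring, add_neg_cancel, laguerre_neg_one_zero,
    Finset.Nat.sum_antidiagonal_eq_sum_range_succ_mk] at h
  rw [← Finset.Ico_add_one_right_eq_Icc, Finset.sum_Ico_eq_sum_range,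
    show j + n + 1 - j = n + 1 by omega]
  simp only [Nat.add_sub_add_left, Nat.add_sub_cancel_left, Nat.add_eq_left]
  simpa only [mul_comm] using h
end

section
/- For all nonnegative integers i, j with j ≤ i, for any real β, real x and nonzero real c, one has ∑_{k=j}^{i} M_{i-k}^{(-β)}(-x;c) · M_{k-j}^{(β)}(x;c) = δ_{ij} (Kronecker delta). -/
/-- The Meixner polynomial
`M_n^{(β)}(x;c) = ∑_{k=0}^{n} x(x-1)⋯(x-k+1)/k! · (-1/c)^k · (x+β)_{n-k}/(n-k)!`. -/
noncomputable def meixner (β c : ℝ) (x : ℝ) (n : ℕ) : ℝ :=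
  ∑ k ∈ Finset.range (n + 1),
    ((∏ m ∈ Finset.range k, (x - m)) / (Nat.factorial k)) * (-1 / c) ^ k *
      ((ascPochhammer ℝ (n - k)).eval (x + β) / (Nat.factorial (n - k)))

theorem Ring.choose_eq_prod_range_div {K : Type*} [Field K] [CharZero K]
    (x : K) (k : ℕ) :
    Ring.choose x k = (∏ m ∈ Finset.range k, (x - m)) / (Nat.factorial k) := by
  rw [Ring.choose_eq_smul, ← Polynomial.aeval_eq_smeval, Polynomial.aeval_def,
    Polynomial.eval₂_eq_eval_map]
  simp [descPochhammer_eval_eq_prod_range, div_eq_inv_mul]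

theorem Ring.neg_one_pow_mul_choose_neg {K : Type*} [Field K] [CharZero K]
    (y : K) (k : ℕ) :
    (-1) ^ k * Ring.choose (-y) k = (ascPochhammer K k).eval y / (Nat.factorial k) := by
  rw [Ring.choose_eq_prod_range_div, ← descPochhammer_eval_eq_prod_range, mul_div_assoc',
    ← ascPochhammer_eval_neg_eq_descPochhammer, neg_neg]

/-- The generating function of the Meixner polynomials, `(1 - t/c)^x (1 - t)^(-x-β)`, as a formal
power series. -/
theorem PowerSeries.mk_meixner (β c x : ℝ) :
    PowerSeries.mk (meixner β c x) =
      PowerSeries.rescale (-1 / c) (PowerSeries.binomialSeries ℝ x) *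
        PowerSeries.rescale (-1) (PowerSeries.binomialSeries ℝ (-(x + β))) := by
  ext n
  rw [PowerSeries.coeff_mul, PowerSeries.coeff_mk, meixner,
    Finset.Nat.sum_antidiagonal_eq_sum_range_succ_mk]
  refine Finset.sum_congr rfl fun k _ => ?_
  simp only [PowerSeries.coeff_rescale, PowerSeries.binomialSeries_coeff, smul_eq_mul, mul_one]
  rw [Ring.neg_one_pow_mul_choose_neg, Ring.choose_eq_prod_range_div, mul_comm ((-1 / c) ^ k)]

theorem PowerSeries.mk_meixner_neg_mul_mk_meixner (β c x : ℝ) :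
    PowerSeries.mk (meixner (-β) c (-x)) * PowerSeries.mk (meixner β c x) = 1 := by
  rw [PowerSeries.mk_meixner, PowerSeries.mk_meixner, mul_mul_mul_comm, ← map_mul, ← map_mul,
    ← PowerSeries.binomialSeries_add, ← PowerSeries.binomialSeries_add, neg_add_cancel,
    show -(-x + -β) + -(x + β) = 0 by ring, PowerSeries.binomialSeries_zero, map_one, map_one,
    mul_one]

/-- Inversion formula for the Meixner polynomials:
`∑_{k=j}^{i} M_{i-k}^{(-β)}(-x;c) M_{k-j}^{(β)}(x;c) = δ_{ij}`. -/
theorem meixner_inversion (β c x : ℝ) (hc : c ≠ 0) (i j : ℕ) (hij : j ≤ i) :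
    ∑ k ∈ Finset.Icc j i, meixner (-β) c (-x) (i - k) * meixner β c x (k - j) =
      if i = j then 1 else 0 := by
  obtain ⟨n, rfl⟩ := Nat.exists_eq_add_of_le hij
  have h := congrArg (PowerSeries.coeff n) (PowerSeries.mk_meixner_neg_mul_mk_meixner β c x)
  rw [mul_comm, PowerSeries.coeff_mul, Finset.Nat.sum_antidiagonal_eq_sum_range_succ_mk,
    PowerSeries.coeff_one] at h
  simp only [PowerSeries.coeff_mk] at h
  rw [← Finset.Ico_add_one_right_eq_Icc, Finset.sum_Ico_eq_sum_range,
    show j + n + 1 - j = n + 1 by lia]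
  simp only [Nat.add_sub_add_left, Nat.add_sub_cancel_left, Nat.add_eq_left]
  simpa only [mul_comm] using h
end

section
/- Let α, β be real numbers such that α + β + s ≠ 0 for every positive integer s. Then for all nonnegative integers i, j with j ≤ i and all real x, one has ∑_{k=j}^{i} [(α+β+2k+1)/((α+β+k+j+1)_{i-j+1})] · P_{i-k}^{(-α-i-1,-β-i-1)}(x) · P_{k-j}^{(α+j,β+j)}(x) = δ_{ij} (Kronecker delta). -/
/-- The Jacobi polynomial with arbitrary real parameters `α`, `β`:
`P_n^{(α,β)}(x) = ∑_{k=0}^{n} (n+α+β+1)_k/k! · (α+k+1)_{n-k}/(n-k)! · ((x-1)/2)^k`. -/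
noncomputable def jacobi (α β : ℝ) (n : ℕ) (x : ℝ) : ℝ :=
  ∑ k ∈ Finset.range (n + 1),
    ((ascPochhammer ℝ k).eval ((n : ℝ) + α + β + 1) / (Nat.factorial k)) *
      ((ascPochhammer ℝ (n - k)).eval (α + k + 1) / (Nat.factorial (n - k))) *
      ((x - 1) / 2) ^ k

open Finset

theorem ascPochhammer_eval_add (m n : ℕ) (z : ℝ) :
    (ascPochhammer ℝ (m + n)).eval z =
      (ascPochhammer ℝ m).eval z * (ascPochhammer ℝ n).eval (z + m) := by
  rw [← ascPochhammer_mul]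
  simp

theorem ascPochhammer_eval_neg_sub (k : ℕ) (z : ℝ) :
    (ascPochhammer ℝ k).eval (-z - k) = (-1) ^ k * (ascPochhammer ℝ k).eval (z + 1) := by
  induction k with
  | zero => simp
  | succ k ih =>
    rw [ascPochhammer_succ_eval k (z + 1), add_comm k 1, ascPochhammer_eval_add,
      show -z - ((1 + k : ℕ) : ℝ) + ((1 : ℕ) : ℝ) = -z - k by push_cast; ring, ih]
    simp only [ascPochhammer_one, Polynomial.eval_X]
    push_cast
    ring

theorem ascPochhammer_eval_ne_zero {z : ℝ} (hz : ∀ s : ℕ, z + s ≠ 0) (k : ℕ) :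
    (ascPochhammer ℝ k).eval z ≠ 0 := by
  induction k with
  | zero => simp
  | succ k ih =>
    rw [ascPochhammer_succ_eval]
    exact mul_ne_zero ih (hz k)

theorem sum_range_alternating_choose_div_ascPochhammer {y : ℝ} (hy : ∀ s : ℕ, y + s ≠ 0)
    (M R : ℕ) :
    ∑ r ∈ range (R + 1), (-1) ^ r * ((M + 1).choose r : ℝ) * (y + 2 * r) /
        (ascPochhammer ℝ (M + 2)).eval (y + r) =
      (-1) ^ R * (M.choose R : ℝ) / (ascPochhammer ℝ (M + 1)).eval (y + R + 1) := by
  have shift (r s : ℕ) : y + r + s ≠ 0 := by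
    rw [add_assoc, ← Nat.cast_add]
    exact hy _
  have split (r : ℕ) : (ascPochhammer ℝ (M + 2)).eval (y + r) =
      (y + r) * (ascPochhammer ℝ (M + 1)).eval (y + r + 1) := by
    rw [show M + 2 = 1 + (M + 1) by ring, ascPochhammer_eval_add]
    simp
  induction R with
  | zero =>
    have h0 : y ≠ 0 := by simpa using hy 0
    rw [sum_range_one, split]
    simp only [Nat.cast_zero, add_zero, pow_zero, Nat.choose_zero_right, Nat.cast_one, mul_zero,
      one_mul]
    rw [div_mul_eq_div_div, div_self h0]
  | succ R ih =>
    have hA : (ascPochhammer ℝ (M + 2)).eval (y + (R + 1 : ℕ)) ≠ 0 :=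
      ascPochhammer_eval_ne_zero (shift _) _
    have split' : (ascPochhammer ℝ (M + 2)).eval (y + (R + 1 : ℕ)) =
        (ascPochhammer ℝ (M + 1)).eval (y + R + 1) * (y + (R + 1 : ℕ) + (M + 1 : ℕ)) := by
      rw [ascPochhammer_succ_eval]
      push_cast
      ring_nf
    have hB : (ascPochhammer ℝ (M + 1)).eval (y + R + 1) ≠ 0 := by
      rw [split'] at hA
      exact left_ne_zero_of_mul hA
    have hC : (ascPochhammer ℝ (M + 1)).eval (y + (R + 1 : ℕ) + 1) ≠ 0 := by
      rw [split] at hA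
      exact right_ne_zero_of_mul hA
    have e1 : 1 / (ascPochhammer ℝ (M + 1)).eval (y + R + 1) =
        (y + (R + 1 : ℕ) + (M + 1 : ℕ)) / (ascPochhammer ℝ (M + 2)).eval (y + (R + 1 : ℕ)) := by
      rw [div_eq_div_iff hB hA, split']
      ring
    have e2 : 1 / (ascPochhammer ℝ (M + 1)).eval (y + (R + 1 : ℕ) + 1) =
        (y + (R + 1 : ℕ)) / (ascPochhammer ℝ (M + 2)).eval (y + (R + 1 : ℕ)) := by
      rw [div_eq_div_iff hC hA, split]
      ring
    have hpascal : ((M + 1).choose (R + 1) : ℝ) = M.choose R + M.choose (R + 1) := by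
      exact_mod_cast Nat.choose_succ_succ M R
    have habsorb : ((M : ℝ) + 1) * M.choose R = (M + 1).choose (R + 1) * (R + 1) := by
      exact_mod_cast Nat.add_one_mul_choose_eq M R
    rw [sum_range_succ, ih, ← mul_one_div _ ((ascPochhammer ℝ (M + 1)).eval (y + R + 1)), e1,
      ← mul_one_div _ ((ascPochhammer ℝ (M + 1)).eval _), e2, mul_div_assoc', mul_div_assoc',
      ← add_div]
    congr 1
    rw [hpascal] at habsorb ⊢
    push_cast
    rw [pow_succ]
    linear_combination (-1 : ℝ) ^ R * habsorb

theorem one_div_factorial_mul_factorial {M r s : ℕ} (h : r + s = M) :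
    (1 : ℝ) / (r.factorial * s.factorial) = M.choose r / M.factorial := by
  subst h
  rw [div_eq_div_iff (by positivity) (by positivity), one_mul]
  rw [← Nat.add_choose_mul_factorial_mul_factorial, Nat.choose_symm_add]
  push_cast
  ring

theorem sum_antidiagonal_alternating_div_ascPochhammer {y : ℝ} (hy : ∀ s : ℕ, y + s ≠ 0)
    (M : ℕ) :
    ∑ q ∈ antidiagonal M, (-1) ^ q.2 * (y + 2 * q.1) /
        (ascPochhammer ℝ (M + 1)).eval (y + q.1) * (1 / (q.1.factorial * q.2.factorial)) =
      if M = 0 then 1 else 0 := by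
  rcases M with _ | M
  · have h0 : y ≠ 0 := by simpa using hy 0
    simp [h0]
  · rw [if_neg (Nat.succ_ne_zero M)]
    have key := sum_range_alternating_choose_div_ascPochhammer hy M (M + 1)
    rw [Nat.choose_succ_self, Nat.cast_zero, mul_zero, zero_div] at key
    rw [← mul_zero ((-1 : ℝ) ^ (M + 1) / (M + 1).factorial), ← key, mul_sum,
      ← Nat.sum_antidiagonal_eq_sum_range_succ (fun r _ => (-1 : ℝ) ^ (M + 1) / (M + 1).factorial *
        ((-1) ^ r * ((M + 1).choose r : ℝ) * (y + 2 * r) /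
        (ascPochhammer ℝ (M + 2)).eval (y + r)))]
    refine sum_congr rfl fun q hq => ?_
    rw [HasAntidiagonal.mem_antidiagonal] at hq
    have hsign : (-1 : ℝ) ^ (M + 1) * (-1) ^ q.1 = (-1) ^ q.2 := by
      rw [← hq, pow_add, mul_right_comm, ← mul_pow]
      simp
    rw [one_div_factorial_mul_factorial hq, ← hsign]
    ring

theorem sum_antidiagonal_alternating_one_div_factorial (n : ℕ) :
    ∑ q ∈ antidiagonal n, (-1 : ℝ) ^ q.2 * (1 / (q.1.factorial * q.2.factorial)) =
      if n = 0 then 1 else 0 := by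
  have h := add_pow (1 : ℝ) (-1) n
  rw [← Nat.sum_antidiagonal_eq_sum_range_succ
    (fun r s => (1 : ℝ) ^ r * (-1) ^ s * (n.choose r : ℝ)), add_neg_cancel, zero_pow_eq] at h
  have hn : (if n = 0 then (1 : ℝ) else 0) = (if n = 0 then 1 else 0) / n.factorial := by
    split_ifs with h0 <;> simp [h0]
  rw [hn, h, sum_div]
  refine sum_congr rfl fun q hq => ?_
  rw [one_div_factorial_mul_factorial (HasAntidiagonal.mem_antidiagonal.mp hq)]
  ring

theorem sum_antidiagonal_antidiagonal_comm_s17 {A : Type*} [AddCommMonoid A] (n : ℕ)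
    (f : ℕ → ℕ → ℕ → ℕ → A) :
    ∑ p ∈ antidiagonal n, ∑ u ∈ antidiagonal p.1, ∑ v ∈ antidiagonal p.2, f u.1 u.2 v.1 v.2 =
      ∑ p ∈ antidiagonal n, ∑ u ∈ antidiagonal p.1, ∑ v ∈ antidiagonal p.2,
        f u.1 v.1 u.2 v.2 := by
  simp only [← sum_product', sum_sigma']
  refine sum_nbij'
    (fun z => ⟨(z.2.1.1 + z.2.2.1, z.2.1.2 + z.2.2.2), (z.2.1.1, z.2.2.1), (z.2.1.2, z.2.2.2)⟩)
    (fun z => ⟨(z.2.1.1 + z.2.2.1, z.2.1.2 + z.2.2.2), (z.2.1.1, z.2.2.1), (z.2.1.2, z.2.2.2)⟩)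
    ?_ ?_ ?_ ?_ ?_
  · rintro ⟨⟨p, q⟩, ⟨k, r⟩, ⟨l, s⟩⟩ h
    simp only [mem_sigma, mem_product, HasAntidiagonal.mem_antidiagonal, and_true] at h ⊢
    omega
  · rintro ⟨⟨p, q⟩, ⟨k, r⟩, ⟨l, s⟩⟩ h
    simp only [mem_sigma, mem_product, HasAntidiagonal.mem_antidiagonal, and_true] at h ⊢
    omega
  · rintro ⟨⟨p, q⟩, ⟨k, r⟩, ⟨l, s⟩⟩ h
    simp only [mem_sigma, mem_product, HasAntidiagonal.mem_antidiagonal] at h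
    obtain ⟨-, rfl, rfl⟩ := h
    rfl
  · rintro ⟨⟨p, q⟩, ⟨k, r⟩, ⟨l, s⟩⟩ h
    simp only [mem_sigma, mem_product, HasAntidiagonal.mem_antidiagonal] at h
    obtain ⟨-, rfl, rfl⟩ := h
    rfl
  · rintro ⟨⟨p, q⟩, ⟨k, r⟩, ⟨l, s⟩⟩ h
    rfl

theorem jacobi_eq_sum_antidiagonal (a b : ℝ) (n : ℕ) (x : ℝ) :
    jacobi a b n x = ∑ u ∈ antidiagonal n,
      ((ascPochhammer ℝ u.1).eval ((n : ℝ) + a + b + 1) / (Nat.factorial u.1)) *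
        ((ascPochhammer ℝ u.2).eval (a + u.1 + 1) / (Nat.factorial u.2)) *
        ((x - 1) / 2) ^ u.1 :=
  (Nat.sum_antidiagonal_eq_sum_range_succ (fun k s =>
    ((ascPochhammer ℝ k).eval ((n : ℝ) + a + b + 1) / (Nat.factorial k)) *
        ((ascPochhammer ℝ s).eval (a + k + 1) / (Nat.factorial s)) *
        ((x - 1) / 2) ^ k) n).symm

/-- Product of a single term of `P_q^{(-a-n-1,-b-n-1)}` and a single term of `P_p^{(a,b)}`, where
`p = k + r`, `q = l + s` and `n = p + q`, after cancellation of Pochhammer symbols. -/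
theorem jacobi_term_mul_term {a b : ℝ} (hab : ∀ s : ℕ, 1 ≤ s → a + b + s ≠ 0) (t : ℝ)
    (k r l s : ℕ) :
    (a + b + 2 * (k + r : ℕ) + 1) /
        (ascPochhammer ℝ (k + r + (l + s) + 1)).eval (a + b + (k + r : ℕ) + 1) *
      ((ascPochhammer ℝ l).eval (((l + s : ℕ) : ℝ) + (-a - (k + r + (l + s) : ℕ) - 1) +
          (-b - (k + r + (l + s) : ℕ) - 1) + 1) / l.factorial *
        ((ascPochhammer ℝ s).eval (-a - (k + r + (l + s) : ℕ) - 1 + l + 1) / s.factorial) *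
        t ^ l) *
      ((ascPochhammer ℝ k).eval (((k + r : ℕ) : ℝ) + a + b + 1) / k.factorial *
        ((ascPochhammer ℝ r).eval (a + k + 1) / r.factorial) * t ^ k) =
    (ascPochhammer ℝ (r + s)).eval (a + k + 1) * t ^ (k + l) *
      ((-1) ^ l * (1 / (k.factorial * l.factorial))) *
      ((-1) ^ s * (a + b + 2 * k + 1 + 2 * r) /
        (ascPochhammer ℝ (r + s + 1)).eval (a + b + 2 * k + 1 + r) *
        (1 / (r.factorial * s.factorial))) := by
  have e1 : (ascPochhammer ℝ l).eval (((l + s : ℕ) : ℝ) + (-a - (k + r + (l + s) : ℕ) - 1) +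
      (-b - (k + r + (l + s) : ℕ) - 1) + 1) =
      (-1) ^ l * (ascPochhammer ℝ l).eval (a + b + 2 * k + 2 * r + s + 2) := by
    rw [show a + b + 2 * k + 2 * r + s + 2 = (a + b + 2 * k + 2 * r + s + 1) + 1 by ring,
      ← ascPochhammer_eval_neg_sub]
    push_cast
    ring_nf
  have e2 : (ascPochhammer ℝ s).eval (-a - (k + r + (l + s) : ℕ) - 1 + l + 1) =
      (-1) ^ s * (ascPochhammer ℝ s).eval (a + k + 1 + r) := by
    rw [show a + k + 1 + r = (a + k + r) + 1 by ring, ← ascPochhammer_eval_neg_sub]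
    push_cast
    ring_nf
  have e3 : (ascPochhammer ℝ (k + r + (l + s) + 1)).eval (a + b + (k + r : ℕ) + 1) =
      (ascPochhammer ℝ k).eval (((k + r : ℕ) : ℝ) + a + b + 1) *
      (ascPochhammer ℝ (r + s + 1)).eval (a + b + 2 * k + 1 + r) *
      (ascPochhammer ℝ l).eval (a + b + 2 * k + 2 * r + s + 2) := by
    rw [show k + r + (l + s) + 1 = k + (r + s + 1) + l by ring, ascPochhammer_eval_add,
      ascPochhammer_eval_add]
    push_cast
    ring_nf
  have hne : (ascPochhammer ℝ (k + r + (l + s) + 1)).eval (a + b + (k + r : ℕ) + 1) ≠ 0 := by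
    refine ascPochhammer_eval_ne_zero (fun j => ?_) _
    have h := hab (k + r + 1 + j) (by omega)
    push_cast at h ⊢
    convert h using 1
    ring
  rw [e3] at hne
  have hl := right_ne_zero_of_mul hne
  have hk := left_ne_zero_of_mul (left_ne_zero_of_mul hne)
  have hm := right_ne_zero_of_mul (left_ne_zero_of_mul hne)
  rw [e1, e2, e3, ascPochhammer_eval_add r s]
  generalize (ascPochhammer ℝ l).eval (a + b + 2 * k + 2 * r + s + 2) = L at *
  generalize (ascPochhammer ℝ k).eval (((k + r : ℕ) : ℝ) + a + b + 1) = K at *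
  generalize (ascPochhammer ℝ (r + s + 1)).eval (a + b + 2 * k + 1 + r) = Z at *
  push_cast
  field_simp
  ring

theorem sum_antidiagonal_jacobi_mul_jacobi {a b : ℝ} (hab : ∀ s : ℕ, 1 ≤ s → a + b + s ≠ 0)
    (n : ℕ) (x : ℝ) :
    ∑ p ∈ antidiagonal n,
        (a + b + 2 * p.1 + 1) / (ascPochhammer ℝ (n + 1)).eval (a + b + p.1 + 1) *
          jacobi (-a - n - 1) (-b - n - 1) p.2 x * jacobi a b p.1 x =
      if n = 0 then 1 else 0 := by
  set t := (x - 1) / 2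
  let f : ℕ → ℕ → ℕ → ℕ → ℝ := fun k r l s =>
    (ascPochhammer ℝ (r + s)).eval (a + k + 1) * t ^ (k + l) *
      ((-1) ^ l * (1 / (k.factorial * l.factorial))) *
      ((-1) ^ s * (a + b + 2 * k + 1 + 2 * r) /
        (ascPochhammer ℝ (r + s + 1)).eval (a + b + 2 * k + 1 + r) *
        (1 / (r.factorial * s.factorial)))
  calc
    _ = ∑ p ∈ antidiagonal n, ∑ u ∈ antidiagonal p.1, ∑ v ∈ antidiagonal p.2,
          f u.1 u.2 v.1 v.2 := by
      refine sum_congr rfl fun p hp => ?_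
      simp only [jacobi_eq_sum_antidiagonal, mul_sum, sum_mul]
      refine sum_congr rfl fun u hu => sum_congr rfl fun v hv => ?_
      rw [HasAntidiagonal.mem_antidiagonal] at hp hu hv
      rw [← hp, ← hu, ← hv]
      exact jacobi_term_mul_term hab t u.1 u.2 v.1 v.2
    _ = ∑ p ∈ antidiagonal n, ∑ u ∈ antidiagonal p.1, ∑ v ∈ antidiagonal p.2,
          f u.1 v.1 u.2 v.2 := sum_antidiagonal_antidiagonal_comm_s17 n f
    _ = ∑ p ∈ antidiagonal n, ∑ u ∈ antidiagonal p.1,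
          (ascPochhammer ℝ p.2).eval (a + u.1 + 1) * t ^ p.1 *
            ((-1) ^ u.2 * (1 / (u.1.factorial * u.2.factorial))) * if p.2 = 0 then 1 else 0 := by
      refine sum_congr rfl fun p _ => sum_congr rfl fun u hu => ?_
      have hy (s : ℕ) : a + b + 2 * u.1 + 1 + s ≠ 0 := by
        have h := hab (2 * u.1 + 1 + s) (by omega)
        push_cast at h
        convert h using 1
        ring
      rw [← sum_antidiagonal_alternating_div_ascPochhammer hy, mul_sum]
      refine sum_congr rfl fun v hv => ?_
      rw [HasAntidiagonal.mem_antidiagonal] at hu hv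
      simp only [f, hu, hv]
    _ = ∑ u ∈ antidiagonal n, t ^ n * ((-1) ^ u.2 * (1 / (u.1.factorial * u.2.factorial))) := by
      rw [sum_eq_single_of_mem (n, 0) (by simp)]
      · simp
      · rintro ⟨p, q⟩ hp hne
        rw [HasAntidiagonal.mem_antidiagonal] at hp
        have hq : q ≠ 0 := by
          rintro rfl
          exact hne (by simpa using hp)
        simp [hq]
    _ = if n = 0 then 1 else 0 := by
      rw [← mul_sum, sum_antidiagonal_alternating_one_div_factorial]
      split_ifs with h <;> simp [h]

/-- Inversion formula for the Jacobi polynomials: if `α + β + s ≠ 0` for every positive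
integer `s`, then `∑_{k=j}^{i} (α+β+2k+1)/((α+β+k+j+1)_{i-j+1})
P_{i-k}^{(-α-i-1,-β-i-1)}(x) P_{k-j}^{(α+j,β+j)}(x) = δ_{ij}`. -/
theorem jacobi_inversion (α β : ℝ) (hαβ : ∀ s : ℕ, 1 ≤ s → α + β + s ≠ 0)
    (i j : ℕ) (hij : j ≤ i) (x : ℝ) :
    ∑ k ∈ Finset.Icc j i,
        (α + β + 2 * k + 1) / ((ascPochhammer ℝ (i - j + 1)).eval (α + β + k + j + 1)) *
          jacobi (-α - i - 1) (-β - i - 1) (i - k) x * jacobi (α + j) (β + j) (k - j) x =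
      if i = j then 1 else 0 := by
  obtain ⟨n, rfl⟩ := Nat.exists_eq_add_of_le hij
  have hab (s : ℕ) (hs : 1 ≤ s) : (α + j) + (β + j) + s ≠ 0 := by
    have h := hαβ (2 * j + s) (by omega)
    push_cast at h
    convert h using 1
    ring
  have hcond : (if j + n = j then (1 : ℝ) else 0) = if n = 0 then 1 else 0 := by simp
  rw [hcond, ← sum_antidiagonal_jacobi_mul_jacobi hab n x]
  refine sum_nbij' (fun k => (k - j, j + n - k)) (fun p => j + p.1) ?_ ?_ ?_ ?_ ?_
  · intro k hk
    simp only [mem_Icc, HasAntidiagonal.mem_antidiagonal] at hk ⊢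
    omega
  · intro p hp
    simp only [mem_Icc, HasAntidiagonal.mem_antidiagonal] at hp ⊢
    omega
  · intro k hk
    simp only [mem_Icc] at hk ⊢
    omega
  · rintro ⟨p, q⟩ hp
    simp only [HasAntidiagonal.mem_antidiagonal] at hp
    simp only [Prod.mk.injEq]
    omega
  · intro k hk
    obtain ⟨m, rfl⟩ := Nat.exists_eq_add_of_le (mem_Icc.mp hk).1
    simp only [Nat.add_sub_cancel_left]
    push_cast
    ring_nf
end
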